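/- arXiv:1511.01823 — 8 statements merged into one kernel-verified Lean document; each statement's English description precedes it below -/
import Mathlib

section
/- For every natural number n ≥ 2, the sum of the reciprocals 1/j over all positive integers j all of whose prime factors are at most n equals the product over all primes p ≤ n of (1 - 1/p)^{-1}; in particular this (infinite) sum converges. -/
theorem Nat.smoothNumbers_succ_eq_setOf (n : ℕ) :
    (n + 1).smoothNumbers = {j : ℕ | 0 < j ∧ ∀ p : ℕ, p.Prime → p ∣ j → p ≤ n} := by
  ext j
  rw [Nat.mem_smoothNumbers, Set.mem_ofPred_eq, Nat.pos_iff_ne_zero]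
  refine and_congr_right fun hj => forall_congr' fun p => ?_
  rw [Nat.mem_primeFactorsList hj, and_imp, Nat.lt_succ_iff]

theorem hasSum_one_div_smoothNumbers (N : ℕ) :
    HasSum (fun j : N.smoothNumbers => (1 : ℝ) / (j : ℕ))
      (∏ p ∈ N.primesBelow, ((1 : ℝ) - 1 / p)⁻¹) := by
  let f : ℕ →* ℝ :=
    { toFun := fun j => 1 / (j : ℝ)
      map_one' := by simp
      map_mul' := fun a b => by simp [mul_comm] }
  refine (EulerProduct.summable_and_hasSum_smoothNumbers_prod_primesBelow_geometric
    (f := f) (fun {p} hp => ?_) N).2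
  have hp' : (1 : ℝ) < p := by exact_mod_cast hp.one_lt
  simpa [f] using inv_lt_one_of_one_lt₀ hp'

theorem tsum_smooth_numbers_eq_prod (n : ℕ) (hn : 2 ≤ n) :
    Summable (fun j : {j : ℕ // 0 < j ∧ ∀ p : ℕ, p.Prime → p ∣ j → p ≤ n} => (1 : ℝ) / j) ∧
      (∑' j : {j : ℕ // 0 < j ∧ ∀ p : ℕ, p.Prime → p ∣ j → p ≤ n}, (1 : ℝ) / j) =
        ∏ p ∈ Finset.filter Nat.Prime (Finset.range (n + 1)), ((1 : ℝ) - 1 / p)⁻¹ := by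
  have h := hasSum_one_div_smoothNumbers (n + 1)
  rw [Nat.smoothNumbers_succ_eq_setOf] at h
  exact ⟨h.summable, h.tsum_eq⟩
end

section
/- There is a constant C such that for every natural number n ≥ 2, the sum of 1/p over all primes p ≤ n is at least ln(ln n) - C. -/
/-- The harmonic sum up to `n` is bounded by the Euler product over the primes up to `n`. -/
lemma harmonic_le_prod_primesBelow (n : ℕ) :
    (harmonic n : ℝ) ≤ ∏ p ∈ (n + 1).primesBelow, (1 - (p : ℝ)⁻¹)⁻¹ := by
  let f : ℕ →* ℝ :=
    { toFun := fun m ↦ (m : ℝ)⁻¹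
      map_one' := by simp
      map_mul' := fun a b ↦ by push_cast; rw [mul_inv] }
  have hf {p : ℕ} (hp : p.Prime) : ‖f p‖ < 1 := by
    have : (1 : ℝ) < p := by exact_mod_cast hp.one_lt
    simpa [f] using inv_lt_one_of_one_lt₀ this
  have hsum := (EulerProduct.summable_and_hasSum_smoothNumbers_prod_primesBelow_geometric
    hf (n + 1)).2
  have hmem (m : ℕ) (hm : m ∈ Finset.Icc 1 n) : m ∈ (n + 1).smoothNumbers := by
    rw [Finset.mem_Icc] at hm
    exact Nat.mem_smoothNumbers_of_lt (by lia) (by lia)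
  have hle := sum_le_hasSum ((Finset.Icc 1 n).subtype (· ∈ (n + 1).smoothNumbers))
    (fun m _ ↦ inv_nonneg.mpr (Nat.cast_nonneg (m : ℕ))) hsum
  rw [harmonic_eq_sum_Icc]
  push_cast
  refine le_of_eq_of_le ?_ hle
  exact (Finset.sum_subtype_of_mem (fun m : ℕ ↦ (m : ℝ)⁻¹) hmem).symm

/-- Replacing `1 / (p - 1)` by `1 / p` costs at most a telescoping sum. -/
lemma sum_primesBelow_inv_sub_one_le {n : ℕ} (hn : 1 ≤ n) :
    ∑ p ∈ (n + 1).primesBelow, ((p : ℝ) - 1)⁻¹ ≤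
      ∑ p ∈ (n + 1).primesBelow, (1 : ℝ) / p + 1 - (n : ℝ)⁻¹ := by
  induction n, hn using Nat.le_induction with
  | base => simp [Nat.primesBelow_two]
  | succ n hn ih =>
    have hpos : (0 : ℝ) < n := by exact_mod_cast hn
    rw [Nat.primesBelow_succ (n + 1)]
    split_ifs with hp
    · rw [Finset.sum_insert (Nat.notMem_primesBelow _),
        Finset.sum_insert (Nat.notMem_primesBelow _)]
      push_cast
      rw [add_sub_cancel_right, one_div]
      linarith
    · have : ((n + 1 : ℕ) : ℝ)⁻¹ ≤ (n : ℝ)⁻¹ := by gcongr; lia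
      linarith

theorem sum_one_div_primes_ge : ∃ C : ℝ, ∀ n : ℕ, 2 ≤ n →
    Real.log (Real.log n) - C ≤
      ∑ p ∈ Finset.filter Nat.Prime (Finset.range (n + 1)), (1 : ℝ) / p := by
  refine ⟨1, fun n hn ↦ ?_⟩
  rw [← Nat.primesBelow_eq_filter_range]
  have hn' : (1 : ℝ) < n := by exact_mod_cast hn
  have hp {p : ℕ} (h : p ∈ (n + 1).primesBelow) : (1 : ℝ) < p := by
    exact_mod_cast Nat.one_lt_of_mem_primesBelow h
  have hfac {p : ℕ} (h : p ∈ (n + 1).primesBelow) : 0 < (1 - (p : ℝ)⁻¹)⁻¹ :=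
    inv_pos.mpr (sub_pos.mpr (inv_lt_one_of_one_lt₀ (hp h)))
  have hlog : Real.log n ≤ ∏ p ∈ (n + 1).primesBelow, (1 - (p : ℝ)⁻¹)⁻¹ := by
    refine le_trans ?_ (harmonic_le_prod_primesBelow n)
    simpa using log_le_harmonic_floor n (Nat.cast_nonneg n)
  have hterm {p : ℕ} (h : p ∈ (n + 1).primesBelow) :
      Real.log (1 - (p : ℝ)⁻¹)⁻¹ ≤ ((p : ℝ) - 1)⁻¹ := by
    refine (Real.log_le_sub_one_of_pos (hfac h)).trans_eq ?_
    have h0 : (p : ℝ) ≠ 0 := by linarith [hp h]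
    have h1 : (p : ℝ) - 1 ≠ 0 := by linarith [hp h]
    field_simp
    ring
  have hloglog : Real.log (Real.log n) ≤ ∑ p ∈ (n + 1).primesBelow, ((p : ℝ) - 1)⁻¹ :=
    calc Real.log (Real.log n)
        ≤ Real.log (∏ p ∈ (n + 1).primesBelow, (1 - (p : ℝ)⁻¹)⁻¹) :=
          Real.log_le_log (Real.log_pos hn') hlog
      _ = ∑ p ∈ (n + 1).primesBelow, Real.log (1 - (p : ℝ)⁻¹)⁻¹ :=
          Real.log_prod fun p h ↦ (hfac h).ne'
      _ ≤ _ := Finset.sum_le_sum fun p h ↦ hterm h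
  have htel := sum_primesBelow_inv_sub_one_le (show 1 ≤ n by lia)
  have : (0 : ℝ) ≤ (n : ℝ)⁻¹ := by positivity
  linarith
end

section
/- For every natural number n ≥ 2, ln(ln n) ≤ ∑_{p ≤ n, p prime} (1/p + 1/p²). -/
/-- `-ln (1 - x) ≤ x + x²` on `[0, 1/2]`, in exponential form. -/
theorem inv_one_sub_le_exp_add_sq {x : ℝ} (hx₀ : 0 ≤ x) (hx₁ : x ≤ 1 / 2) :
    (1 - x)⁻¹ ≤ Real.exp (x + x ^ 2) := by
  have hexp := Real.quadratic_le_exp_of_nonneg (show 0 ≤ x + x ^ 2 by positivity)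
  refine le_trans ?_ hexp
  rw [inv_le_iff_one_le_mul₀' (by linarith)]
  have h₂ : x ^ 2 ≤ 1 / 4 := by nlinarith
  have h₃ : x ^ 3 ≤ 1 / 8 := by nlinarith
  have h : 0 ≤ x ^ 2 * (1 - x - x ^ 2 - x ^ 3) := mul_nonneg (sq_nonneg x) (by linarith)
  nlinarith

/-- The harmonic sum up to `n` is at most the partial Euler product over primes `p ≤ n`. -/
theorem sum_inv_le_prod_primesBelow (n : ℕ) :
    ∑ i ∈ Finset.range n, ((i + 1 : ℕ) : ℝ)⁻¹ ≤
      ∏ p ∈ (n + 1).primesBelow, (1 - (p : ℝ)⁻¹)⁻¹ := by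
  let f : ℕ →* ℝ := (invMonoidWithZeroHom : ℝ →*₀ ℝ).toMonoidHom.comp
    (Nat.castRingHom ℝ : ℕ →* ℝ)
  have hf {p : ℕ} (hp : p.Prime) : ‖f p‖ < 1 := by
    change ‖(p : ℝ)⁻¹‖ < 1
    rw [norm_inv, Real.norm_natCast]
    exact inv_lt_one_of_one_lt₀ (by exact_mod_cast hp.one_lt)
  have hsum := (EulerProduct.summable_and_hasSum_smoothNumbers_prod_primesBelow_geometric
    (f := f) hf (n + 1)).2
  have hmem (i : ℕ) (hi : i ∈ Finset.range n) : i + 1 ∈ (n + 1).smoothNumbers :=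
    Nat.mem_smoothNumbers_of_lt i.succ_pos (by simpa using hi)
  have hle := sum_le_hasSum
    ((Finset.range n).attach.image fun i ↦ (⟨i.1 + 1, hmem i.1 i.2⟩ : (n + 1).smoothNumbers))
    (fun m _ ↦ inv_nonneg.mpr (Nat.cast_nonneg (m : ℕ))) hsum
  rw [Finset.sum_image fun i _ j _ hij ↦
    Subtype.ext (Nat.succ_injective (congrArg Subtype.val hij))] at hle
  rw [← Finset.sum_attach]
  exact hle

theorem log_log_le_sum (n : ℕ) (hn : 2 ≤ n) :
    Real.log (Real.log n) ≤
      ∑ p ∈ Finset.filter Nat.Prime (Finset.range (n + 1)), ((1 : ℝ) / p + 1 / p^2) := by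
  have hn' : (1 : ℝ) < n := by exact_mod_cast hn
  rw [Real.log_le_iff_le_exp (Real.log_pos hn'), Real.exp_sum]
  calc Real.log n ≤ Real.log ((n + 1 : ℕ) : ℝ) :=
        Real.log_le_log (by linarith) (by push_cast; linarith)
    _ ≤ (harmonic n : ℝ) := log_add_one_le_harmonic n
    _ = ∑ i ∈ Finset.range n, ((i + 1 : ℕ) : ℝ)⁻¹ := by simp [harmonic]
    _ ≤ ∏ p ∈ (n + 1).primesBelow, (1 - (p : ℝ)⁻¹)⁻¹ := sum_inv_le_prod_primesBelow n
    _ ≤ _ := by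
      have hinv (p : ℕ) (hp : p ∈ (n + 1).primesBelow) : (p : ℝ)⁻¹ ≤ 1 / 2 := by
        rw [one_div]
        exact inv_anti₀ two_pos (by exact_mod_cast Nat.two_le_of_mem_primesBelow hp)
      refine Finset.prod_le_prod (fun p hp ↦ inv_nonneg.mpr ?_) fun p hp ↦ ?_
      · linarith [hinv p hp]
      · simpa using inv_one_sub_le_exp_add_sq (by positivity) (hinv p hp)
end

section
/- For every natural number n ≥ 2, n^{π(2n) - π(n)} ≤ 4^n, where π denotes the prime counting function; consequently π(2n) - π(n) ≤ n·ln(4)/ln(n). -/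
/-- The primes in `(m, k]` contribute at least `m` each to the quotient of primorials. -/
lemma pow_primeCounting_sub_mul_primorial_le {m k : ℕ} (h : m ≤ k) :
    m ^ (Nat.primeCounting k - Nat.primeCounting m) * primorial m ≤ primorial k := by
  have hsub : m.primesLE ⊆ k.primesLE := Nat.primesLE_mono h
  rw [← Nat.primesLE_card_eq_primeCounting, ← Nat.primesLE_card_eq_primeCounting,
    ← Finset.card_sdiff_of_subset hsub, primorial_eq_prod_primesLE, primorial_eq_prod_primesLE,
    ← Finset.prod_sdiff hsub, ← Finset.prod_const]
  refine Nat.mul_le_mul_right _ (Finset.prod_le_prod' fun p hp ↦ ?_)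
  simp only [Finset.mem_sdiff, Nat.mem_primesLE, not_and] at hp
  by_contra! hlt
  exact hp.2 hlt.le hp.1.2

/-- The primes in `(n, 2 * n]` contribute at least `n` each to the central binomial coefficient. -/
lemma pow_primeCounting_sub_le_centralBinom (n : ℕ) :
    n ^ (Nat.primeCounting (2 * n) - Nat.primeCounting n) ≤ n.centralBinom := by
  refine Nat.le_of_mul_le_mul_right ?_ (primorial_pos n)
  calc _ ≤ primorial (2 * n) := pow_primeCounting_sub_mul_primorial_le (by lia)
    _ ≤ primorial n * (2 * n).choose n := two_mul n ▸ primorial_add_le le_rfl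
    _ = n.centralBinom * primorial n := by rw [Nat.centralBinom_eq_two_mul_choose, mul_comm]

theorem pow_primeCounting_le (n : ℕ) (hn : 2 ≤ n) :
    n ^ (Nat.primeCounting (2 * n) - Nat.primeCounting n) ≤ 4 ^ n ∧
      ((Nat.primeCounting (2 * n) - Nat.primeCounting n : ℕ) : ℝ) ≤
        n * Real.log 4 / Real.log n := by
  have hpow := (pow_primeCounting_sub_le_centralBinom n).trans (Nat.centralBinom_le_four_pow n)
  refine ⟨hpow, ?_⟩
  rw [le_div_iff₀ (Real.log_pos (by exact_mod_cast hn)), ← Real.log_pow, ← Real.log_pow]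
  exact Real.log_le_log (by positivity) (by exact_mod_cast hpow)
end

section
/- There is a constant C such that for every real number x ≥ 2, π(x) ≤ C·x/ln(x), where π denotes the prime counting function. -/
theorem primeCounting_le : ∃ C : ℝ, ∀ x : ℝ, 2 ≤ x →
    (Nat.primeCounting ⌊x⌋₊ : ℝ) ≤ C * x / Real.log x := by
  refine ⟨2 * Real.log 4 + 2, fun x hx ↦ ?_⟩
  have hlog : 0 < Real.log x := Real.log_pos (by linarith)
  have hsqrt : Real.log √x = Real.log x / 2 := Real.log_sqrt (by linarith)
  have hbound : Real.log x ≤ 2 * √x := by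
    linarith [Real.log_le_self (Real.sqrt_nonneg x)]
  have hsqrt_le : √x ≤ 2 * x / Real.log x := by
    rw [le_div_iff₀ hlog]
    nlinarith [Real.sqrt_nonneg x, Real.mul_self_sqrt (show 0 ≤ x by linarith)]
  calc (Nat.primeCounting ⌊x⌋₊ : ℝ)
      ≤ Real.log 4 * x / Real.log √x + √x := Chebyshev.pi_le_log4_mul_div (by linarith)
    _ ≤ Real.log 4 * x / (Real.log x / 2) + 2 * x / Real.log x := by
        rw [hsqrt]
        gcongr
    _ = (2 * Real.log 4 + 2) * x / Real.log x := by
        field_simp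
end

section
/- There is a constant C such that for every natural number n ≥ 2, the sum of ln(p) over all primes p ≤ n is at most C·n. -/
theorem sum_log_primes_le : ∃ C : ℝ, ∀ n : ℕ, 2 ≤ n →
    ∑ p ∈ Finset.filter Nat.Prime (Finset.range (n + 1)), Real.log p ≤ C * n := by
  refine ⟨Real.log 4, fun n _ ↦ ?_⟩
  have h := Chebyshev.theta_le_log4_mul_x (x := n) n.cast_nonneg
  rwa [Chebyshev.theta_eq_sum_Icc, Nat.floor_natCast, ← Nat.range_succ_eq_Icc_zero] at h
end

section
/- There is a constant C such that for every real number x ≥ 2, the absolute value of (∑_{p ≤ x, p prime} ln(p)/p) - ln(x) is at most C. That is, ∑_{p≤x} ln(p)/p = ln x + O(1). -/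
open Nat in
theorem log_factorial_eq_sum_primesLE (n : ℕ) :
    Real.log (n !) = ∑ p ∈ primesLE n, (n !).factorization p * Real.log p := by
  rw [Real.log_nat_eq_sum_factorization]
  refine Finsupp.sum_of_support_subset _ (fun p hp => ?_) _ (by simp)
  have hpp := prime_of_mem_primeFactors hp
  exact mem_primesLE.2 ⟨(hpp.dvd_factorial).1 (dvd_of_mem_primeFactors hp), hpp⟩

open Nat in
theorem div_sub_one_le_factorization_factorial {p : ℕ} (hp : p.Prime) (n : ℕ) :
    (n : ℝ) / p - 1 ≤ (n !).factorization p := by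
  have hdiv : n / p ≤ (n !).factorization p := by
    calc n / p ≤ (n / p)!.factorization p + n / p := Nat.le_add_left _ _
      _ = (p * (n / p))!.factorization p := (factorization_factorial_mul hp).symm
      _ ≤ (n !).factorization p :=
        (factorization_le_iff_dvd (factorial_ne_zero _) (factorial_ne_zero _)).2
          (factorial_dvd_factorial (mul_div_le n p)) p
  have hlt : (n : ℝ) / p < (n / p : ℕ) + 1 := by
    rw [← floor_div_eq_div (K := ℝ)]
    exact lt_floor_add_one _
  have : ((n / p : ℕ) : ℝ) ≤ (n !).factorization p := by exact_mod_cast hdiv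
  linarith

open Nat in
theorem factorization_factorial_le_div_sub_one {p : ℕ} (hp : p.Prime) (n : ℕ) :
    ((n !).factorization p : ℝ) ≤ n / ((p : ℝ) - 1) := by
  calc ((n !).factorization p : ℝ) ≤ (n / (p - 1) : ℕ) := by
        exact_mod_cast factorization_factorial_le_div_pred hp n
    _ ≤ n / ((p - 1 : ℕ) : ℝ) := cast_div_le
    _ = n / ((p : ℝ) - 1) := by rw [cast_pred hp.pos]

theorem log_div_mul_sub_one_le_rpow {x : ℝ} (hx : 2 ≤ x) :
    Real.log x / (x * (x - 1)) ≤ 4 * (1 / x ^ (3 / 2 : ℝ)) := by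
  have hx0 : 0 < x := by linarith
  have hlog : Real.log x ≤ x ^ (1 / 2 : ℝ) / (1 / 2) :=
    Real.log_le_rpow_div hx0.le (by norm_num)
  have hmul : x ^ (1 / 2 : ℝ) * x ^ (3 / 2 : ℝ) = x ^ 2 := by
    rw [← Real.rpow_add hx0]
    norm_num
  rw [mul_one_div, div_le_div_iff₀ (by nlinarith) (by positivity)]
  calc Real.log x * x ^ (3 / 2 : ℝ) ≤ x ^ (1 / 2 : ℝ) / (1 / 2) * x ^ (3 / 2 : ℝ) := by gcongr
    _ = 2 * (x ^ (1 / 2 : ℝ) * x ^ (3 / 2 : ℝ)) := by ring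
    _ = 2 * x ^ 2 := by rw [hmul]
    _ ≤ 4 * (x * (x - 1)) := by nlinarith

theorem exists_sum_primesLE_log_div_mul_sub_one_le :
    ∃ K : ℝ, ∀ n : ℕ, ∑ p ∈ Nat.primesLE n, Real.log p / ((p : ℝ) * (p - 1)) ≤ K := by
  have hs : Summable fun n : ℕ => 4 * (1 / (n : ℝ) ^ (3 / 2 : ℝ)) :=
    (Real.summable_one_div_nat_rpow.2 (by norm_num)).mul_left 4
  refine ⟨_, fun n => (Finset.sum_le_sum fun p hp => ?_).trans
    (hs.sum_le_tsum (Nat.primesLE n) fun p _ => by positivity)⟩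
  exact log_div_mul_sub_one_le_rpow (by exact_mod_cast Nat.two_le_of_mem_primesLE hp)

theorem sum_primesLE_log_div_le {n : ℕ} (hn : n ≠ 0) :
    ∑ p ∈ Nat.primesLE n, Real.log p / p ≤ Real.log n + Real.log 4 := by
  have hn0 : (0 : ℝ) < n := by positivity
  have hfac : Real.log n.factorial ≤ n * Real.log n := by
    rw [← Real.log_pow]
    exact Real.log_le_log (by positivity) (by exact_mod_cast n.factorial_le_pow)
  have hsum : n * ∑ p ∈ Nat.primesLE n, Real.log p / p - Chebyshev.theta n
      ≤ Real.log n.factorial := by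
    rw [log_factorial_eq_sum_primesLE, Chebyshev.theta_eq_sum_primesLE_log, Finset.mul_sum,
      ← Finset.sum_sub_distrib]
    refine Finset.sum_le_sum fun p hp => ?_
    calc n * (Real.log p / p) - Real.log p = (n / p - 1) * Real.log p := by ring
      _ ≤ _ := mul_le_mul_of_nonneg_right
        (div_sub_one_le_factorization_factorial (Nat.prime_of_mem_primesLE hp) n)
        (Real.log_natCast_nonneg p)
  have htheta := Chebyshev.theta_le_log4_mul_x hn0.le
  refine le_of_mul_le_mul_left ?_ hn0
  linarith

theorem log_sub_one_le_sum_primesLE_add {n : ℕ} (hn : n ≠ 0) :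
    Real.log n - 1 ≤ ∑ p ∈ Nat.primesLE n, Real.log p / p +
      ∑ p ∈ Nat.primesLE n, Real.log p / ((p : ℝ) * (p - 1)) := by
  have hn0 : (0 : ℝ) < n := by positivity
  have hfac : n * Real.log n - n ≤ Real.log n.factorial := by
    have hstirling := Stirling.le_log_factorial_stirling hn
    have hlog := Real.log_natCast_nonneg n
    have hpi : 0 ≤ Real.log (2 * Real.pi) := Real.log_nonneg (by linarith [Real.pi_gt_three])
    linarith
  have hsum : Real.log n.factorial ≤ n * (∑ p ∈ Nat.primesLE n, Real.log p / p +
      ∑ p ∈ Nat.primesLE n, Real.log p / ((p : ℝ) * (p - 1))) := by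
    rw [log_factorial_eq_sum_primesLE, ← Finset.sum_add_distrib, Finset.mul_sum]
    refine Finset.sum_le_sum fun p hp => ?_
    have hp1 : (1 : ℝ) < p := by exact_mod_cast Nat.one_lt_of_mem_primesLE hp
    have hp1' : (p : ℝ) - 1 ≠ 0 := by linarith
    calc _ ≤ n / ((p : ℝ) - 1) * Real.log p := mul_le_mul_of_nonneg_right
          (factorization_factorial_le_div_sub_one (Nat.prime_of_mem_primesLE hp) n)
          (Real.log_natCast_nonneg p)
      _ = _ := by
        field_simp
        ring
  refine le_of_mul_le_mul_left ?_ hn0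
  linarith

theorem log_le_log_floor_add_log_two {x : ℝ} (hx : 1 ≤ x) :
    Real.log x ≤ Real.log ⌊x⌋₊ + Real.log 2 := by
  have hfloor : (1 : ℝ) ≤ ⌊x⌋₊ := by exact_mod_cast (Nat.one_le_floor_iff x).2 hx
  rw [← Real.log_mul (by positivity) two_ne_zero]
  exact Real.log_le_log (by linarith) (by linarith [Nat.lt_floor_add_one x])

theorem mertens_first : ∃ C : ℝ, ∀ x : ℝ, 2 ≤ x →
    |(∑ p ∈ Finset.filter Nat.Prime (Finset.range (⌊x⌋₊ + 1)), Real.log p / p) -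
      Real.log x| ≤ C := by
  obtain ⟨K, hK⟩ := exists_sum_primesLE_log_div_mul_sub_one_le
  refine ⟨max (Real.log 4) (1 + K + Real.log 2), fun x hx => ?_⟩
  rw [← Nat.primesLE_eq_filter_range]
  have hn : ⌊x⌋₊ ≠ 0 := (Nat.floor_pos.2 (by linarith)).ne'
  have hfloor : Real.log ⌊x⌋₊ ≤ Real.log x :=
    Real.log_le_log (by positivity) (Nat.floor_le (by linarith))
  have hupper := sum_primesLE_log_div_le hn
  have hlower := log_sub_one_le_sum_primesLE_add hn
  have hlog := log_le_log_floor_add_log_two (x := x) (by linarith)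
  have hKn := hK ⌊x⌋₊
  rw [abs_le']
  exact ⟨le_max_of_le_left (by linarith), le_max_of_le_right (by linarith)⟩
end

section
/- There is a constant C such that for every natural number n ≥ 3, ∑_{p ≤ n, p prime} 1/p ≤ ln(ln n) + C. -/
/-- The product of the prime powers `p ^ (n / p)` over the primes `p ≤ n` divides `n !`. -/
theorem prod_primes_pow_div_dvd_factorial (n : ℕ) :
    ∏ p ∈ Finset.filter Nat.Prime (Finset.range (n + 1)), p ^ (n / p) ∣ n.factorial := by
  refine Finset.prod_dvd_of_isRelPrime ?_ ?_
  · intro p hp q hq hpq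
    rw [Finset.mem_coe, Finset.mem_filter] at hp hq
    exact Nat.coprime_iff_isRelPrime.1
      (Nat.Coprime.pow _ _ ((Nat.coprime_primes hp.2 hq.2).2 hpq))
  · intro p hp
    have hp' := (Finset.mem_filter.1 hp).2
    rw [hp'.pow_dvd_factorial_iff (b := Nat.log p n + 2) (by omega)]
    calc n / p = n / p ^ 1 := by rw [pow_one]
      _ ≤ _ := Finset.single_le_sum (f := fun i => n / p ^ i) (fun _ _ => Nat.zero_le _)
        (Finset.mem_Ico.2 ⟨le_rfl, by omega⟩)

/-- The upper half of Mertens' first theorem. -/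
theorem sum_log_div_primes_le {n : ℕ} (hn : 1 ≤ n) :
    ∑ p ∈ Finset.filter Nat.Prime (Finset.range (n + 1)), Real.log p / p ≤
      Real.log n + Real.log 4 := by
  have hn0 : (0 : ℝ) < n := by exact_mod_cast hn
  have hfact : ∑ p ∈ Finset.filter Nat.Prime (Finset.range (n + 1)),
      ((n / p : ℕ) : ℝ) * Real.log p ≤ n * Real.log n := by
    have h : ∏ p ∈ Finset.filter Nat.Prime (Finset.range (n + 1)), p ^ (n / p) ≤ n ^ n :=
      (Nat.le_of_dvd n.factorial_pos (prod_primes_pow_div_dvd_factorial n)).trans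
        n.factorial_le_pow
    have hpos : 0 < ∏ p ∈ Finset.filter Nat.Prime (Finset.range (n + 1)), p ^ (n / p) :=
      Finset.prod_pos fun p hp => pow_pos (Finset.mem_filter.1 hp).2.pos _
    have hlog := Real.log_le_log (by exact_mod_cast hpos) (Nat.cast_le (α := ℝ).2 h)
    push_cast at hlog
    rw [Real.log_prod, Real.log_pow] at hlog
    · simpa only [Real.log_pow] using hlog
    · intro p hp
      exact pow_ne_zero _ (Nat.cast_ne_zero.2 (Finset.mem_filter.1 hp).2.ne_zero)
  have htheta : ∑ p ∈ Finset.filter Nat.Prime (Finset.range (n + 1)), Real.log p ≤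
      Real.log 4 * n := by
    have h := Chebyshev.theta_le_log4_mul_x hn0.le
    rwa [Chebyshev.theta_eq_sum_primesLE_log] at h
  have hsum : n * ∑ p ∈ Finset.filter Nat.Prime (Finset.range (n + 1)), Real.log p / p ≤
      ∑ p ∈ Finset.filter Nat.Prime (Finset.range (n + 1)), ((n / p : ℕ) : ℝ) * Real.log p +
      ∑ p ∈ Finset.filter Nat.Prime (Finset.range (n + 1)), Real.log p := by
    rw [Finset.mul_sum, ← Finset.sum_add_distrib]
    refine Finset.sum_le_sum fun p _ => ?_
    have hdiv : (n : ℝ) / p ≤ ((n / p : ℕ) : ℝ) + 1 := by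
      rw [← Nat.floor_div_eq_div (K := ℝ)]
      exact (Nat.lt_floor_add_one _).le
    calc (n : ℝ) * (Real.log p / p) = n / p * Real.log p := by ring
      _ ≤ (((n / p : ℕ) : ℝ) + 1) * Real.log p := by
        gcongr
      _ = _ := by ring
  refine le_of_mul_le_mul_left ?_ hn0
  linarith

/-- The inductive form of summation by parts used to pass from `∑ log p / p` to `∑ 1 / p`. -/
theorem sum_one_div_primes_sub_le {n : ℕ} (hn : 2 ≤ n) :
    ∑ p ∈ Finset.filter Nat.Prime (Finset.range (n + 1)), (1 : ℝ) / p -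
      (∑ p ∈ Finset.filter Nat.Prime (Finset.range (n + 1)), Real.log p / p - Real.log 4) /
        Real.log n ≤ Real.log (Real.log n) + (2 - Real.log (Real.log 2)) := by
  induction n, hn using Nat.le_induction with
  | base =>
    have h2 : Finset.filter Nat.Prime (Finset.range (2 + 1)) = {2} := by decide
    have hlog2 : 0 < Real.log 2 := Real.log_pos (by norm_num)
    have h4 : Real.log 4 = 2 * Real.log 2 := by
      rw [show (4 : ℝ) = 2 ^ 2 by norm_num, Real.log_pow]
      norm_num
    rw [h2, h4]
    simp only [Finset.sum_singleton, Nat.cast_ofNat]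
    have : (Real.log 2 / 2 - 2 * Real.log 2) / Real.log 2 = -3 / 2 := by
      field_simp
      norm_num
    rw [this]
    linarith
  | succ n hn ih =>
    have hL : 0 < Real.log n := Real.log_pos (by exact_mod_cast hn)
    have hL' : 0 < Real.log (n + 1 : ℕ) := Real.log_pos (by exact_mod_cast (by omega))
    have hLL : Real.log n ≤ Real.log (n + 1 : ℕ) :=
      Real.log_le_log (by positivity) (by push_cast; linarith)
    have hS := sum_log_div_primes_le (n := n) (by omega)
    set S := ∑ p ∈ Finset.filter Nat.Prime (Finset.range (n + 1)), Real.log p / p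
    set P := ∑ p ∈ Finset.filter Nat.Prime (Finset.range (n + 1)), (1 : ℝ) / p
    have hstep : ∑ p ∈ Finset.filter Nat.Prime (Finset.range (n + 1 + 1)), (1 : ℝ) / p -
        (∑ p ∈ Finset.filter Nat.Prime (Finset.range (n + 1 + 1)), Real.log p / p -
          Real.log 4) / Real.log (n + 1 : ℕ) = P - (S - Real.log 4) / Real.log (n + 1 : ℕ) := by
      rw [Finset.range_add_one, Finset.filter_insert]
      split_ifs with hp
      · rw [Finset.sum_insert (by simp), Finset.sum_insert (by simp)]
        have hn1 : ((n + 1 : ℕ) : ℝ) ≠ 0 := by positivity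
        field_simp
        ring
      · rfl
    rw [hstep]
    have hinv : 0 ≤ 1 / Real.log n - 1 / Real.log (n + 1 : ℕ) :=
      sub_nonneg.2 (one_div_le_one_div_of_le hL hLL)
    have hdiff : (S - Real.log 4) * (1 / Real.log n - 1 / Real.log (n + 1 : ℕ)) ≤
        1 - Real.log n / Real.log (n + 1 : ℕ) :=
      calc _ ≤ Real.log n * (1 / Real.log n - 1 / Real.log (n + 1 : ℕ)) := by
            gcongr
            linarith
        _ = _ := by field_simp
    have hlog := Real.log_le_sub_one_of_pos (div_pos hL hL')
    rw [Real.log_div hL.ne' hL'.ne'] at hlog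
    have hsplit : (S - Real.log 4) * (1 / Real.log n - 1 / Real.log (n + 1 : ℕ)) =
        (S - Real.log 4) / Real.log n - (S - Real.log 4) / Real.log (n + 1 : ℕ) := by ring
    linarith

theorem sum_one_div_primes_le : ∃ C : ℝ, ∀ n : ℕ, 3 ≤ n →
    ∑ p ∈ Finset.filter Nat.Prime (Finset.range (n + 1)), (1 : ℝ) / p ≤
      Real.log (Real.log n) + C := by
  refine ⟨3 - Real.log (Real.log 2), fun n hn => ?_⟩
  have hL : 0 < Real.log n := Real.log_pos (by exact_mod_cast (by omega))
  have hS : (∑ p ∈ Finset.filter Nat.Prime (Finset.range (n + 1)), Real.log p / p -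
      Real.log 4) / Real.log n ≤ 1 := by
    rw [div_le_one hL]
    linarith [sum_log_div_primes_le (n := n) (by omega)]
  linarith [sum_one_div_primes_sub_le (n := n) (by omega)]
end
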